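/- Suppose α(ρ) := ρ f''(ρ)/f'(ρ) has a finite limit as ρ → 0⁺ and α∞ := lim_{ρ→+∞} α(ρ) exists with α∞ > 0. Then there exist constants q₁, q₂ with 1 < q₁ < q₂ < ∞ and constants c₁, c₂ > 0 such that for all ρ ≥ 0: c₁ρ^{q₁} − c₂ ≤ f(ρ) ≤ c₁ρ^{q₂} + c₂ and c₁ρ^{q₁−1} − c₂ ≤ f'(ρ) ≤ c₁ρ^{q₂−1} + c₂. -/

import Mathlib

open Set MeasureTheory Metric Filter
open scoped Topology

noncomputable section

/-- The (one-sided at `0`) derivative of `f` on `[0,∞)`. -/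
def dtop (f : ℝ → ℝ) : ℝ → ℝ := derivWithin f (Set.Ici 0)

/-- Standing assumptions on the Lagrangian `f` : strictly convex on `[0,∞)`, `C¹` on `[0,∞)`,
`C²` on `(0,∞)` with `f''` locally Hölder continuous of some exponent `λ ∈ (0,1)`,
and `f'(0) > 0`. -/
def StdF (f : ℝ → ℝ) : Prop :=
  StrictConvexOn ℝ (Set.Ici 0) f ∧ ContDiffOn ℝ 1 f (Set.Ici 0) ∧
  ContDiffOn ℝ 2 f (Set.Ioi 0) ∧
  (∃ lam : NNReal, 0 < lam ∧ lam < 1 ∧ ∀ K : Set ℝ, IsCompact K → K ⊆ Set.Ioi 0 →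
    ∃ C : NNReal, HolderOnWith C lam (deriv (dtop f)) K) ∧
  0 < dtop f 0

/-- An Euler-type differential inequality `a g ≤ ρ g'` forces growth at least like `ρ ^ a`. -/
theorem mul_rpow_le_of_mul_le_mul_deriv {g : ℝ → ℝ} {a R : ℝ} (hR : 0 < R)
    (hg : ∀ x, R ≤ x → DifferentiableAt ℝ g x) (h : ∀ x, R ≤ x → a * g x ≤ x * deriv g x)
    {x : ℝ} (hx : R ≤ x) : g R * R ^ (-a) * x ^ a ≤ g x := by
  have hd : ∀ y, R ≤ y → HasDerivAt (fun y => g y * y ^ (-a))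
      (deriv g y * y ^ (-a) + g y * (-a * y ^ (-a - 1))) y := fun y hy =>
    (hg y hy).hasDerivAt.mul (Real.hasDerivAt_rpow_const (Or.inl (hR.trans_le hy).ne'))
  have hmono : MonotoneOn (fun y => g y * y ^ (-a)) (Ici R) := by
    refine monotoneOn_of_deriv_nonneg (convex_Ici R)
      (fun y hy => (hd y hy).continuousAt.continuousWithinAt)
      (fun y hy => (hd y (interior_subset hy)).differentiableAt.differentiableWithinAt) ?_
    intro y hy
    have hy' : R ≤ y := interior_subset hy
    have hy0 : 0 < y := hR.trans_le hy'
    rw [(hd y hy').deriv, Real.rpow_sub_one hy0.ne']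
    have : deriv g y * y ^ (-a) + g y * (-a * (y ^ (-a) / y))
        = (y * deriv g y - a * g y) * (y ^ (-a) / y) := by
      field_simp
      ring
    rw [this]
    exact mul_nonneg (sub_nonneg.2 (h y hy')) (by positivity)
  have hx0 : 0 < x := hR.trans_le hx
  calc g R * R ^ (-a) * x ^ a ≤ g x * x ^ (-a) * x ^ a :=
        mul_le_mul_of_nonneg_right (hmono self_mem_Ici hx hx) (by positivity)
    _ = g x := by rw [mul_assoc, ← Real.rpow_add hx0]; simp

/-- A function continuous on `[0,∞)` and eventually bounded below is bounded below on `[0,∞)`. -/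
theorem exists_forall_nonneg_neg_le {F : ℝ → ℝ} (hF : ContinuousOn F (Ici 0)) {m : ℝ}
    (h : ∀ᶠ x in atTop, m ≤ F x) : ∃ C, ∀ x, 0 ≤ x → -C ≤ F x := by
  obtain ⟨R, hR⟩ := eventually_atTop.1 h
  obtain ⟨B, hB⟩ := (isCompact_Icc (a := (0 : ℝ)) (b := R)).bddBelow_image
    (hF.mono Icc_subset_Ici_self)
  refine ⟨max (-m) (-B), fun x hx => ?_⟩
  rcases le_total R x with hRx | hxR
  · linarith [hR x hRx, le_max_left (-m) (-B)]
  · linarith [hB (mem_image_of_mem F ⟨hx, hxR⟩), le_max_right (-m) (-B)]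

/-- If the derivative is eventually nonnegative, the function is bounded below on `[0,∞)`. -/
theorem exists_forall_nonneg_neg_le_of_hasDerivAt {F F' : ℝ → ℝ} (hF : ContinuousOn F (Ici 0))
    (hd : ∀ x, 0 < x → HasDerivAt F (F' x) x) (h : ∀ᶠ x in atTop, 0 ≤ F' x) :
    ∃ C, ∀ x, 0 ≤ x → -C ≤ F x := by
  obtain ⟨R, hR⟩ := eventually_atTop.1 (h.and (eventually_gt_atTop 0))
  have hmono : MonotoneOn F (Ici R) := by
    refine monotoneOn_of_deriv_nonneg (convex_Ici R)
      (fun y hy => (hd y (hR y hy).2).continuousAt.continuousWithinAt)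
      (fun y hy => (hd y (hR y (interior_subset hy)).2).differentiableAt.differentiableWithinAt) ?_
    intro y hy
    have hy' := hR y (interior_subset hy)
    rw [(hd y hy'.2).deriv]
    exact hy'.1
  exact exists_forall_nonneg_neg_le hF
    ((eventually_ge_atTop R).mono fun x hx => hmono self_mem_Ici hx hx)

/-- A positive multiple of a larger power eventually dominates any multiple of a smaller one. -/
theorem eventually_mul_rpow_le_mul_rpow {s t : ℝ} (hst : s < t) (C : ℝ) {k : ℝ} (hk : 0 < k) :
    ∀ᶠ x : ℝ in atTop, C * x ^ s ≤ k * x ^ t := by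
  filter_upwards [(tendsto_rpow_atTop (sub_pos.2 hst)).eventually_ge_atTop (C / k),
    eventually_gt_atTop 0] with x hx hx0
  have : x ^ t = x ^ (t - s) * x ^ s := by rw [← Real.rpow_add hx0]; simp
  rw [this, ← mul_assoc]
  exact mul_le_mul_of_nonneg_right ((div_le_iff₀' hk).1 hx) (by positivity)

theorem StdF.hasDerivAt {f : ℝ → ℝ} (hf : StdF f) {x : ℝ} (hx : 0 < x) :
    HasDerivAt f (dtop f x) x :=
  ((hf.2.1.differentiableOn one_ne_zero x hx.le).hasDerivWithinAt).hasDerivAt (Ici_mem_nhds hx)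

theorem StdF.differentiableAt_dtop {f : ℝ → ℝ} (hf : StdF f) {x : ℝ} (hx : 0 < x) :
    DifferentiableAt ℝ (dtop f) x := by
  have h : ContDiffOn ℝ 1 (deriv f) (Ioi 0) :=
    hf.2.2.1.deriv_of_isOpen isOpen_Ioi (by norm_num)
  have hx' : Ioi (0 : ℝ) ∈ 𝓝 x := Ioi_mem_nhds hx
  refine ((h.differentiableOn one_ne_zero).differentiableAt hx').congr_of_eventuallyEq ?_
  filter_upwards [hx'] with y hy using (hf.hasDerivAt hy).deriv.symm

theorem StdF.continuousOn_dtop {f : ℝ → ℝ} (hf : StdF f) : ContinuousOn (dtop f) (Ici 0) :=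
  hf.2.1.continuousOn_derivWithin (uniqueDiffOn_Ici 0) le_rfl

theorem StdF.dtop_pos {f : ℝ → ℝ} (hf : StdF f) {x : ℝ} (hx : 0 ≤ x) : 0 < dtop f x :=
  hf.2.2.2.2.trans_le (hf.1.convexOn.monotoneOn_derivWithin
    (hf.2.1.differentiableOn one_ne_zero) self_mem_Ici hx hx)

/-- If `α(ρ) = ρ f''(ρ)/f'(ρ)` has a finite limit at `0⁺` and a strictly
positive limit `α∞` at `+∞`, then `f` and `f'` satisfy two-sided power growth bounds with
exponents `1 < q₁ < q₂ < ∞`. -/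
theorem growth_bounds
    (f : ℝ → ℝ) (hf : StdF f)
    (hlim0 : ∃ ℓ : ℝ, Tendsto (fun ρ => ρ * deriv (dtop f) ρ / dtop f ρ)
      (nhdsWithin 0 (Set.Ioi 0)) (nhds ℓ))
    (αinf : ℝ) (hαinf : 0 < αinf)
    (hliminf : Tendsto (fun ρ => ρ * deriv (dtop f) ρ / dtop f ρ) atTop (nhds αinf)) :
    ∃ q₁ q₂ c₁ c₂ : ℝ, 1 < q₁ ∧ q₁ < q₂ ∧ 0 < c₁ ∧ 0 < c₂ ∧
      ∀ ρ : ℝ, 0 ≤ ρ →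
        (c₁ * ρ ^ q₁ - c₂ ≤ f ρ ∧ f ρ ≤ c₁ * ρ ^ q₂ + c₂) ∧
        (c₁ * ρ ^ (q₁ - 1) - c₂ ≤ dtop f ρ ∧ dtop f ρ ≤ c₁ * ρ ^ (q₂ - 1) + c₂) := by
  have hpow {q : ℝ} (hq : 0 < q) : ContinuousOn (fun x : ℝ => x ^ q) (Ici 0) :=
    (Real.continuous_rpow_const hq.le).continuousOn
  have hlow : ∀ᶠ x in atTop, αinf / 2 * dtop f x ≤ x * deriv (dtop f) x := by
    filter_upwards [hliminf.eventually (lt_mem_nhds (half_lt_self hαinf)),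
      eventually_gt_atTop 0] with x hx hx0
    exact ((lt_div_iff₀ (hf.dtop_pos hx0.le)).1 hx).le
  have hupp : ∀ᶠ x in atTop, x * deriv (dtop f) x ≤ 2 * αinf * dtop f x := by
    filter_upwards [hliminf.eventually (gt_mem_nhds (show αinf < 2 * αinf by linarith)),
      eventually_gt_atTop 0] with x hx hx0
    exact ((div_lt_iff₀ (hf.dtop_pos hx0.le)).1 hx).le
  obtain ⟨R, hR⟩ := eventually_atTop.1 ((hlow.and hupp).and (eventually_gt_atTop 0))
  have hR0 : 0 < R := (hR R le_rfl).2
  have hgR := hf.dtop_pos hR0.le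
  have hgd : ∀ x, R ≤ x → DifferentiableAt ℝ (dtop f) x := fun x hx =>
    hf.differentiableAt_dtop (hR0.trans_le hx)
  have hg_low (C : ℝ) : ∀ᶠ x in atTop, C * x ^ (αinf / 4) ≤ dtop f x := by
    filter_upwards [eventually_mul_rpow_le_mul_rpow (show αinf / 4 < αinf / 2 by linarith) C
      (mul_pos hgR (Real.rpow_pos_of_pos hR0 (-(αinf / 2)))), eventually_ge_atTop R] with x hx hRx
    exact hx.trans
      (mul_rpow_le_of_mul_le_mul_deriv hR0 hgd (fun y hy => (hR y hy).1.1) hRx)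
  have hg_upp : ∀ᶠ x in atTop, dtop f x ≤ x ^ (3 * αinf) := by
    filter_upwards [eventually_mul_rpow_le_mul_rpow (show 2 * αinf < 3 * αinf by linarith)
      (dtop f R * R ^ (-(2 * αinf))) one_pos, eventually_ge_atTop R] with x hx hRx
    have h := mul_rpow_le_of_mul_le_mul_deriv (g := fun y => -dtop f y) (a := 2 * αinf) hR0
      (fun y hy => (hgd y hy).neg)
      (fun y hy => by rw [deriv.fun_neg]; linarith [(hR y hy).1.2]) hRx
    linarith
  have hfc : ContinuousOn f (Ici 0) := hf.2.1.continuousOn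
  have hgc := hf.continuousOn_dtop
  obtain ⟨A, hA⟩ := exists_forall_nonneg_neg_le_of_hasDerivAt
    (F := fun x => f x - x ^ (1 + αinf / 4)) (hfc.sub (hpow (by linarith)))
    (fun x hx => (hf.hasDerivAt hx).sub (Real.hasDerivAt_rpow_const (Or.inl hx.ne')))
    (by
      filter_upwards [hg_low (1 + αinf / 4)] with x hx
      rw [add_sub_cancel_left]
      linarith)
  obtain ⟨B, hB⟩ := exists_forall_nonneg_neg_le_of_hasDerivAt
    (F := fun x => x ^ (1 + 3 * αinf) - f x) ((hpow (by linarith)).sub hfc)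
    (fun x hx => (Real.hasDerivAt_rpow_const (Or.inl hx.ne')).sub (hf.hasDerivAt hx))
    (by
      filter_upwards [hg_upp, eventually_gt_atTop 0] with x hx hx0
      rw [add_sub_cancel_left]
      have : 0 ≤ 3 * αinf * x ^ (3 * αinf) := by positivity
      linarith)
  obtain ⟨C, hC⟩ := exists_forall_nonneg_neg_le (m := 0)
    (F := fun x => dtop f x - x ^ (αinf / 4)) (hgc.sub (hpow (by linarith)))
    ((hg_low 1).mono fun x hx => by linarith)
  obtain ⟨D, hD⟩ := exists_forall_nonneg_neg_le (m := 0)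
    (F := fun x => x ^ (3 * αinf) - dtop f x) ((hpow (by linarith)).sub hgc)
    (hg_upp.mono fun x hx => by linarith)
  refine ⟨1 + αinf / 4, 1 + 3 * αinf, 1, |A| + |B| + |C| + |D| + 1, by linarith, by linarith,
    one_pos, by positivity, fun x hx => ?_⟩
  rw [add_sub_cancel_left, add_sub_cancel_left]
  have := hA x hx
  have := hB x hx
  have := hC x hx
  have := hD x hx
  have := le_abs_self A
  have := le_abs_self B
  have := le_abs_self C
  have := le_abs_self D
  have := abs_nonneg A
  have := abs_nonneg B
  have := abs_nonneg C
  have := abs_nonneg D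
  refine ⟨⟨?_, ?_⟩, ?_, ?_⟩ <;> linarith
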